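/- Suppose the family of chains X^{(a)} satisfies the 0^ℓ-SD condition. Then E[T^a_0] / E[T^0_a] → 0 as a → ∞: the mean time for the abrupt convergence from a to the root is negligible compared to the mean escape time from the root to a. -/

import Mathlib

open MeasureTheory ProbabilityTheory Filter Topology ENNReal

noncomputable section

/-- A discrete-time birth-and-death chain on a countable rooted tree `I`.
The tree is encoded by a root, a parent map and a depth function; the chain is
encoded by its transition matrix `P` (nonzero only between tree-neighbours and
on the diagonal) and by the laws `law x` of the trajectories started at `x`,
characterised by the cylinder formula.  `invm` is the reversible invariant
probability measure of the chain (positive recurrence). -/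
structure TreeChain (I : Type*) [MeasurableSpace I] where
  root : I
  par : I → I
  depth : I → ℕ
  par_root : par root = root
  depth_root : depth root = 0
  depth_eq_zero : ∀ x, depth x = 0 → x = root
  depth_par : ∀ x, x ≠ root → depth x = depth (par x) + 1
  P : I → I → ℝ≥0∞
  P_row : ∀ x, ∑' y, P x y = 1
  P_support : ∀ x y, P x y ≠ 0 → y = x ∨ y = par x ∨ x = par y
  lam_pos : ∀ x, x ≠ root → P (par x) x ≠ 0
  mu_pos : ∀ x, x ≠ root → P x (par x) ≠ 0
  law : I → Measure (ℕ → I)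
  law_prob : ∀ x, IsProbabilityMeasure (law x)
  law_start : ∀ x, law x {ω | ω 0 = x} = 1
  law_cyl : ∀ x (n : ℕ) (γ : ℕ → I), γ 0 = x →
    law x {ω | ∀ i ≤ n, ω i = γ i} = ∏ i ∈ Finset.range n, P (γ i) (γ (i + 1))
  invm : I → ℝ≥0∞
  invm_pos : ∀ x, invm x ≠ 0
  invm_sum : ∑' x, invm x = 1
  invm_rev : ∀ x y, invm x * P x y = invm y * P y x

/-- The hitting time of `y`, as an extended nonnegative real (`∞` if `y` is never hit). -/
def hitTime {I : Type*} (y : I) (ω : ℕ → I) : ℝ≥0∞ :=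
  ⨅ (t : ℕ) (_ : ω t = y), (t : ℝ≥0∞)

namespace TreeChain

variable {I : Type*} [MeasurableSpace I] (c : TreeChain I)

/-- The branch `B_x` stemming from `x`: the set of descendants of `x` (including `x`). -/
def branch (x : I) : Set I := {y | ∃ n, c.par^[n] y = x}

/-- The set `ℓ(x)` of vertices on the path from `x` to the root, the root excluded. -/
def pathToRoot (x : I) : Set I := {y | ∃ i < c.depth x, c.par^[i] x = y}

/-- The set `σ(x)` of children of `x`. -/
def children (x : I) : Set I := {y | y ≠ c.root ∧ c.par y = x}

/-- `μ_x`, the transition probability from `x` to its parent. -/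
def mu (x : I) : ℝ≥0∞ := c.P x (c.par x)

/-- `λ_x`, the transition probability from the parent of `x` to `x`. -/
def lamP (x : I) : ℝ≥0∞ := c.P (c.par x) x

/-- `π(A)`, the invariant mass of a set of vertices. -/
def piSet (A : Set I) : ℝ≥0∞ := ∑' y : A, c.invm (y : I)

/-- `E[T^x_y]`, the expected hitting time of `y` for the chain started at `x`. -/
def ET (x y : I) : ℝ≥0∞ := ∫⁻ ω, hitTime y ω ∂(c.law x)

/-- `E[(T^x_y)²]`, the second moment of the hitting time of `y` started at `x`. -/
def ET2 (x y : I) : ℝ≥0∞ := ∫⁻ ω, (hitTime y ω) ^ 2 ∂(c.law x)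

/-- The normalised hitting time `T^x_y / E[T^x_y]` as a real random variable. -/
def ratio (x y : I) (ω : ℕ → I) : ℝ := (hitTime y ω).toReal / (c.ET x y).toReal

/-- `α(a)`: the child of the root lying on the path from `a` to the root. -/
def alphaVert (a : I) : I := c.par^[c.depth a - 1] a

/-- The drift constant `K_a = sup_{b ∈ B_{α(a)}} μ_b · E[T^b_{p(b)}]`. -/
def Kdrift (a : I) : ℝ≥0∞ :=
  ⨆ b ∈ c.branch (c.alphaVert a), c.mu b * c.ET b (c.par b)

/-- The global constant `K'_a = sup_{b ∈ I} μ_b · E[T^b_{p(b)}]`. -/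
def Kdrift' : ℝ≥0∞ := ⨆ b : I, c.mu b * c.ET b (c.par b)

/-- The quantity `Q_x = π(B_x)⁻¹ · Σ_{b ∈ B_x} π(B_b)²/(μ_b π(b))`. -/
def Qx (x : I) : ℝ≥0∞ :=
  (c.piSet (c.branch x))⁻¹ *
    ∑' b : c.branch x, (c.piSet (c.branch (b : I))) ^ 2 / (c.mu (b : I) * c.invm (b : I))

/-- `Q_a = sup_{x ∈ ℓ(a)} Q_x`. -/
def Qsup (a : I) : ℝ≥0∞ := ⨆ x ∈ c.pathToRoot a, c.Qx x

/-- `R_a = Σ_{b ∈ ℓ(a)} π(B_b)²/(μ_b π(b))`. -/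
def Rsum (a : I) : ℝ≥0∞ :=
  ∑' b : c.pathToRoot a, (c.piSet (c.branch (b : I))) ^ 2 / (c.mu (b : I) * c.invm (b : I))

/-- The set `C_{a,k}`: union over the vertices `a_l`, `k < l ≤ d(a)`, of the path from
`a_k` to the root, of the branches stemming from the children of `a_l` other
than `a_{l-1}`. -/
def Cset (a : I) (k : ℕ) : Set I :=
  {y | ∃ l, k + 1 ≤ l ∧ l ≤ c.depth a ∧
    ∃ ch, ch ∈ c.children (c.par^[l] a) ∧ ch ≠ c.par^[l - 1] a ∧ y ∈ c.branch ch}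

end TreeChain

/-- The strong drift condition `0^ℓ-SD` toward the root, for a family of chains
`c n` with distinguished vertices `a n` (the limit `a → ∞` being `n → ∞`). -/
def StrongDrift {I : ℕ → Type*} [∀ n, MeasurableSpace (I n)]
    (c : ∀ n, TreeChain (I n)) (a : ∀ n, I n) : Prop :=
  (∃ Kmu : ℝ≥0∞, 0 < Kmu ∧
      ∀ n, ∀ b ∈ (c n).branch ((c n).alphaVert (a n)), Kmu ≤ (c n).mu b) ∧
  Tendsto (fun n => ((c n).Kdrift (a n)) ^ 2 / (c n).ET (a n) (c n).root) atTop (𝓝 0)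

namespace TreeChain

lemma tsum_indicator_add_compl {I : Type*} (B : Set I) (f : I → ℝ≥0∞) :
    ∑' x, B.indicator f x + ∑' x, Bᶜ.indicator f x = ∑' x, f x := by
  rw [← ENNReal.tsum_add]
  exact tsum_congr fun x => Set.indicator_self_add_compl_apply B f x

section Measurability

variable {I : Type*} [MeasurableSpace I]

/-- Product-measurable sets cannot separate trajectories which are coordinatewise inseparable. -/
lemma mem_iff_of_measurableSet_pi {T : Set (ℕ → I)} (hT : MeasurableSet T) {ω ω' : ℕ → I}
    (h : ∀ i, ∀ S : Set I, MeasurableSet S → (ω i ∈ S ↔ ω' i ∈ S)) : ω ∈ T ↔ ω' ∈ T := by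
  let m : MeasurableSpace (ℕ → I) :=
    { MeasurableSet' := fun T => ω ∈ T ↔ ω' ∈ T
      measurableSet_empty := by simp
      measurableSet_compl := fun s hs => by simpa using not_congr hs
      measurableSet_iUnion := fun f hf => by
        simp only [Set.mem_iUnion]
        exact exists_congr hf }
  have hle : (MeasurableSpace.pi : MeasurableSpace (ℕ → I)) ≤ m := by
    refine iSup_le fun i => ?_
    rintro _ ⟨S, hS, rfl⟩
    exact h i S hS
  exact hle T hT

lemma exists_P_ne_zero (c : TreeChain I) (w : I) : ∃ x, c.P x w ≠ 0 := by
  have h : ∃ x, c.P w x ≠ 0 := by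
    by_contra! h
    simpa [h] using c.P_row w
  obtain ⟨x, hx⟩ := h
  refine ⟨x, fun h0 => ?_⟩
  have := c.invm_rev w x
  rw [h0, mul_zero] at this
  exact mul_ne_zero (c.invm_pos w) hx this

/-- The cylinder formula forces the σ-algebra of a countable state space to be discrete. -/
lemma measurableSingletonClass [Countable I] (c : TreeChain I) : MeasurableSingletonClass I := by
  classical
  refine ⟨fun w => ?_⟩
  obtain ⟨x, hx⟩ := c.exists_P_ne_zero w
  suffices h : measurableAtom w = {w} from h ▸ MeasurableSet.measurableAtom_of_countable w
  refine Set.eq_singleton_iff_unique_mem.2 ⟨mem_measurableAtom_self w, fun z hz => ?_⟩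
  by_contra hzw
  have hsep : ∀ S : Set I, MeasurableSet S → (z ∈ S ↔ w ∈ S) := fun S hS => by
    refine ⟨fun hzS => by_contra fun hwS => ?_, fun hwS => measurableAtom_subset hS hwS hz⟩
    exact measurableAtom_subset hS.compl hwS hz hzS
  let E : I → Set (ℕ → I) := fun v => {ω | ω 0 = x ∧ ω 1 = v}
  have hE : ∀ v, c.law x (E v) = c.P x v := fun v => by
    have := c.law_cyl x 1 (fun i => if i = 0 then x else v) (by simp)
    simp only [Finset.prod_range_one] at this
    simp only [zero_add, one_ne_zero, if_true, if_false] at this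
    rw [← this]
    congr 1
    ext ω
    constructor
    · rintro ⟨h0, h1⟩ i hi
      interval_cases i <;> simp [h0, h1]
    · intro h
      exact ⟨by simpa using h 0 (by simp), by simpa using h 1 le_rfl⟩
  let E' : Set (ℕ → I) := ⋃ v : ({w}ᶜ : Set I), E v
  have hE'T : E' ⊆ toMeasurable (c.law x) E' := subset_toMeasurable _ _
  have hsub : {ω : ℕ → I | ω 0 = x} ⊆ toMeasurable (c.law x) E' := fun ω hω => by
    by_cases h1 : ω 1 = w
    · have hmem : Function.update ω 1 z ∈ E' :=
        Set.mem_iUnion.2 ⟨⟨z, by simpa using hzw⟩, by simpa [E] using hω⟩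
      refine (mem_iff_of_measurableSet_pi (measurableSet_toMeasurable _ _) fun i S hS => ?_).1
        (hE'T hmem)
      rcases eq_or_ne i 1 with rfl | hi
      · simpa [h1] using hsep S hS
      · simp [Function.update_of_ne hi]
    · exact hE'T (Set.mem_iUnion.2 ⟨⟨ω 1, by simpa using h1⟩, hω, rfl⟩)
  have h1 : 1 ≤ ∑' v : ({w}ᶜ : Set I), c.P x v := by
    calc 1 = c.law x {ω | ω 0 = x} := (c.law_start x).symm
      _ ≤ c.law x (toMeasurable (c.law x) E') := measure_mono hsub
      _ = c.law x E' := measure_toMeasurable _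
      _ ≤ ∑' v : ({w}ᶜ : Set I), c.law x (E v) := measure_iUnion_le _
      _ = _ := by simp only [hE]
  have h2 : c.P x w + ∑' v : ({w}ᶜ : Set I), c.P x v = 1 := by
    rw [← c.P_row x, ← tsum_indicator_add_compl {w} (c.P x), ← tsum_subtype {w},
      ← tsum_subtype ({w}ᶜ : Set I)]
    simp
  have h3 : ∑' v : ({w}ᶜ : Set I), c.P x v ≠ ⊤ :=
    ne_top_of_le_ne_top one_ne_top (h2 ▸ le_add_self)
  have : c.P x w + ∑' v : ({w}ᶜ : Set I), c.P x v ≤ 0 + ∑' v : ({w}ᶜ : Set I), c.P x v := by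
    rw [h2, zero_add]; exact h1
  exact hx (le_zero_iff.1 ((ENNReal.add_le_add_iff_right h3).1 this))

end Measurability

section HittingTimes

lemma measurableSet_avoid {I : Type*} [MeasurableSpace I] [MeasurableSingletonClass I]
    (y : I) (q : ℕ → Prop) : MeasurableSet {ω : ℕ → I | ∀ i, q i → ω i ≠ y} := by
  have h : {ω : ℕ → I | ∀ i, q i → ω i ≠ y} =
      ⋂ (i : ℕ) (_ : q i), (fun ω : ℕ → I => ω i) ⁻¹' {y}ᶜ := by
    ext ω; simp
  rw [h]
  exact MeasurableSet.iInter fun i => MeasurableSet.iInter fun _ =>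
    measurable_pi_apply i (measurableSet_singleton y).compl

lemma measurableSet_cyl {I : Type*} [MeasurableSpace I] [MeasurableSingletonClass I]
    (m : ℕ) (γ : ℕ → I) : MeasurableSet {ω : ℕ → I | ∀ i ≤ m, ω i = γ i} := by
  have h : {ω : ℕ → I | ∀ i ≤ m, ω i = γ i} =
      ⋂ (i : ℕ) (_ : i ≤ m), (fun ω : ℕ → I => ω i) ⁻¹' {γ i} := by
    ext ω; simp
  rw [h]
  exact MeasurableSet.iInter fun i => MeasurableSet.iInter fun _ =>
    measurable_pi_apply i (measurableSet_singleton _)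

lemma hitTime_eq_tsum {I : Type*} (y : I) (ω : ℕ → I) :
    hitTime y ω = ∑' n : ℕ, {ω : ℕ → I | ∀ i ≤ n, ω i ≠ y}.indicator 1 ω := by
  classical
  by_cases h : ∃ t, ω t = y
  · have h1 : hitTime y ω = (Nat.find h : ℝ≥0∞) := by
      refine le_antisymm (iInf₂_le (Nat.find h) (Nat.find_spec h)) (le_iInf₂ fun t ht => ?_)
      exact_mod_cast Nat.find_min' h ht
    rw [h1, tsum_eq_sum (s := Finset.range (Nat.find h))]
    · rw [Finset.sum_congr rfl (g := fun _ => (1 : ℝ≥0∞)), Finset.sum_const, Finset.card_range,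
        nsmul_eq_mul, mul_one]
      intro n hn
      rw [Set.indicator_of_mem]
      · rfl
      · intro i hi
        exact Nat.find_min h (lt_of_le_of_lt hi (Finset.mem_range.1 hn))
    · intro n hn
      refine Set.indicator_of_notMem (fun hω => ?_) _
      exact hω _ (not_lt.1 (fun h' => hn (Finset.mem_range.2 h'))) (Nat.find_spec h)
  · push Not at h
    have h1 : hitTime y ω = ⊤ := by simp [hitTime, h]
    have h2 : ∀ n : ℕ, {ω : ℕ → I | ∀ i ≤ n, ω i ≠ y}.indicator (1 : (ℕ → I) → ℝ≥0∞) ω = 1 :=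
      fun n => Set.indicator_of_mem (show ω ∈ {ω | ∀ i ≤ n, ω i ≠ y} from fun i _ => h i) _
    simp only [h1, h2, ENNReal.tsum_const_eq_top_of_ne_zero one_ne_zero]

open Classical in
/-- The probability that the chain started at `x` avoids `y` up to time `n`. -/
def avoid {I : Type*} [MeasurableSpace I] (c : TreeChain I) (y : I) : ℕ → I → ℝ≥0∞
  | 0, x => if x = y then 0 else 1
  | n + 1, x => if x = y then 0 else ∑' z, c.P x z * avoid c y n z

variable {I : Type*} [MeasurableSpace I] (c : TreeChain I)

lemma avoid_self (y : I) (n : ℕ) : c.avoid y n y = 0 := by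
  cases n <;> simp [avoid]

lemma avoid_zero {x y : I} (h : x ≠ y) : c.avoid y 0 x = 1 := by
  simp [avoid, h]

lemma avoid_succ {x y : I} (h : x ≠ y) (n : ℕ) :
    c.avoid y (n + 1) x = ∑' z, c.P x z * c.avoid y n z := by
  simp [avoid, h]

lemma avoid_le_one (y : I) (n : ℕ) (x : I) : c.avoid y n x ≤ 1 := by
  induction n generalizing x with
  | zero => by_cases h : x = y <;> simp [avoid, h]
  | succ n ih =>
    rcases eq_or_ne x y with rfl | h
    · simp [avoid_self]
    · rw [avoid_succ c h, ← c.P_row x]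
      exact ENNReal.tsum_le_tsum fun z => mul_le_of_le_one_right' (ih z)

lemma law_cyl_avoid [Countable I] [MeasurableSingletonClass I] (x y : I) (n m : ℕ) (γ : ℕ → I)
    (hγ : γ 0 = x) :
    c.law x {ω | (∀ i ≤ m, ω i = γ i) ∧ ∀ i, m ≤ i → i ≤ m + n → ω i ≠ y} =
      (∏ i ∈ Finset.range m, c.P (γ i) (γ (i + 1))) * c.avoid y n (γ m) := by
  classical
  induction n generalizing m γ with
  | zero =>
    rcases eq_or_ne (γ m) y with h | h
    · rw [h, avoid_self, mul_zero]
      convert measure_empty (μ := c.law x)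
      refine Set.eq_empty_of_forall_notMem fun ω hω => ?_
      exact hω.2 m le_rfl le_rfl ((hω.1 m le_rfl).trans h)
    · rw [avoid_zero c h, mul_one, ← c.law_cyl x m γ hγ]
      congr 1
      ext ω
      refine ⟨fun hω => hω.1, fun hω => ⟨hω, fun i h1 h2 => ?_⟩⟩
      obtain rfl : i = m := by omega
      rw [hω i le_rfl]; exact h
  | succ n ih =>
    rcases eq_or_ne (γ m) y with h | h
    · rw [h, avoid_self, mul_zero]
      convert measure_empty (μ := c.law x)
      refine Set.eq_empty_of_forall_notMem fun ω hω => ?_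
      exact hω.2 m le_rfl (by omega) ((hω.1 m le_rfl).trans h)
    · let γ' : I → ℕ → I := fun z => Function.update γ (m + 1) z
      have hγ' : ∀ z, ∀ i ≤ m, γ' z i = γ i := fun z i hi =>
        Function.update_of_ne (by omega) _ _
      have hγm : ∀ z, γ' z (m + 1) = z := fun z => Function.update_self _ _ _
      let F : I → Set (ℕ → I) := fun z =>
        {ω | (∀ i ≤ m + 1, ω i = γ' z i) ∧ ∀ i, m + 1 ≤ i → i ≤ m + 1 + n → ω i ≠ y}
      have hF : {ω : ℕ → I | (∀ i ≤ m, ω i = γ i) ∧ ∀ i, m ≤ i → i ≤ m + (n + 1) → ω i ≠ y} =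
          ⋃ z, F z := by
        ext ω
        simp only [Set.mem_iUnion]
        constructor
        · rintro ⟨h1, h2⟩
          refine ⟨ω (m + 1), fun i hi => ?_, fun i hi hi' => h2 i (by omega) (by omega)⟩
          rcases Nat.le_succ_iff.1 hi with hi | rfl
          · rw [hγ' _ i hi, h1 i hi]
          · exact (hγm _).symm
        · rintro ⟨z, h1, h2⟩
          have h3 : ∀ i ≤ m, ω i = γ i := fun i hi => (h1 i (by omega)).trans (hγ' z i hi)
          refine ⟨h3, fun i hi hi' => ?_⟩
          rcases eq_or_lt_of_le hi with rfl | hi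
          · rw [h3 m le_rfl]; exact h
          · exact h2 i hi (by omega)
      have hdisj : Pairwise (Function.onFun Disjoint F) := fun z z' hz =>
        Set.disjoint_left.2 fun ω h1 h2 => hz <| by
          rw [← hγm z, ← hγm z', ← h1.1 _ le_rfl, ← h2.1 _ le_rfl]
      have hmeas : ∀ z, MeasurableSet (F z) := fun z => by
        have h1 := (measurableSet_cyl (m + 1) (γ' z)).inter
          (measurableSet_avoid y fun i => m + 1 ≤ i ∧ i ≤ m + 1 + n)
        convert h1 using 1
        ext ω
        simp [F]
      rw [hF, measure_iUnion hdisj hmeas, avoid_succ c h, ← ENNReal.tsum_mul_left]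
      refine tsum_congr fun z => ?_
      rw [ih (m + 1) (γ' z) ((hγ' z 0 (by omega)).trans hγ), Finset.prod_range_succ, hγm,
        hγ' z m le_rfl, mul_assoc]
      congr 1
      refine Finset.prod_congr rfl fun i hi => ?_
      rw [Finset.mem_range] at hi
      rw [hγ' z i (by omega), hγ' z (i + 1) (by omega)]

lemma law_avoid [Countable I] [MeasurableSingletonClass I] (x y : I) (n : ℕ) :
    c.law x {ω | ∀ i ≤ n, ω i ≠ y} = c.avoid y n x := by
  have h := c.law_cyl_avoid x y n 0 (fun _ => x) rfl
  simp only [Finset.range_zero, Finset.prod_empty, one_mul, zero_add, nonpos_iff_eq_zero,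
    forall_eq, zero_le, forall_true_left] at h
  rw [← h]
  have := c.law_prob x
  have hae : ∀ᵐ ω ∂c.law x, ω 0 = x :=
    (prob_compl_eq_zero_iff (by simpa using measurableSet_cyl 0 fun _ => x)).2 (c.law_start x)
  refine measure_congr ?_
  filter_upwards [hae] with ω hω
  exact propext ⟨fun h => ⟨hω, h⟩, fun h => h.2⟩

lemma ET_eq_tsum [Countable I] [MeasurableSingletonClass I] (x y : I) :
    c.ET x y = ∑' n, c.avoid y n x := by
  have hmeas : ∀ n : ℕ, MeasurableSet {ω : ℕ → I | ∀ i ≤ n, ω i ≠ y} := fun n =>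
    measurableSet_avoid y (· ≤ n)
  simp only [ET, hitTime_eq_tsum]
  rw [lintegral_tsum fun n => (measurable_one.indicator (hmeas n)).aemeasurable]
  refine tsum_congr fun n => ?_
  rw [lintegral_indicator_one (hmeas n), law_avoid]

lemma ET_self [Countable I] [MeasurableSingletonClass I] (y : I) : c.ET y y = 0 := by
  simp [ET_eq_tsum, avoid_self]

lemma invm_ne_top (x : I) : c.invm x ≠ ⊤ :=
  ne_top_of_le_ne_top one_ne_top (c.invm_sum ▸ ENNReal.le_tsum x)

lemma P_le_one (x z : I) : c.P x z ≤ 1 := c.P_row x ▸ ENNReal.le_tsum z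

lemma P_symm {x z : I} (h : c.P x z ≠ 0) : c.P z x ≠ 0 := fun h0 => by
  have := c.invm_rev x z
  rw [h0, mul_zero] at this
  exact mul_ne_zero (c.invm_pos x) h this

/-- One step of the chain, seen from a set of vertices not containing the target. -/
lemma tsum_indicator_avoid_succ {B : Set I} {y : I} (hy : y ∉ B) (n : ℕ) :
    ∑' x, B.indicator (fun x => c.invm x * c.avoid y (n + 1) x) x =
      ∑' z, c.invm z * c.avoid y n z * ∑' x, B.indicator (c.P z) x := by
  calc ∑' x, B.indicator (fun x => c.invm x * c.avoid y (n + 1) x) x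
      = ∑' x, ∑' z, c.invm z * c.avoid y n z * B.indicator (c.P z) x := by
        refine tsum_congr fun x => ?_
        by_cases hx : x ∈ B
        · have hxy : x ≠ y := fun h => hy (h ▸ hx)
          simp only [Set.indicator_of_mem hx]
          rw [avoid_succ c hxy, ← ENNReal.tsum_mul_left]
          refine tsum_congr fun z => ?_
          rw [← mul_assoc, c.invm_rev x z]
          ring
        · simp [Set.indicator_of_notMem hx]
    _ = _ := by
        rw [ENNReal.tsum_comm]
        exact tsum_congr fun z => ENNReal.tsum_mul_left

lemma tsum_indicator_avoid_zero {B : Set I} {y : I} (hy : y ∉ B) :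
    ∑' x, B.indicator (fun x => c.invm x * c.avoid y 0 x) x = c.piSet B := by
  rw [piSet, tsum_subtype]
  refine tsum_congr fun x => ?_
  by_cases hx : x ∈ B
  · have hxy : x ≠ y := fun h => hy (h ▸ hx)
    simp [hx, avoid_zero c hxy]
  · simp [hx]

lemma piSet_add_compl (B : Set I) : c.piSet B + c.piSet Bᶜ = 1 := by
  simp only [piSet, tsum_subtype]
  rw [tsum_indicator_add_compl, c.invm_sum]

lemma piSet_le_one (B : Set I) : c.piSet B ≤ 1 := c.piSet_add_compl B ▸ le_self_add

lemma invm_mul_P_mul_sum_avoid_le (y z : I) (N : ℕ) :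
    ∑' x, ({y}ᶜ : Set I).indicator (fun x => c.invm x * c.avoid y N x) x +
      c.invm z * c.P z y * ∑ n ∈ Finset.range N, c.avoid y n z ≤ 1 := by
  have hy : y ∉ ({y}ᶜ : Set I) := by simp
  induction N with
  | zero =>
    rw [tsum_indicator_avoid_zero c hy]
    simpa using c.piSet_le_one _
  | succ N ih =>
    refine le_trans ?_ ih
    rw [Finset.sum_range_succ, mul_add, ← add_assoc, add_right_comm]
    refine add_le_add_left ?_ _
    rw [tsum_indicator_avoid_succ c hy]
    have h1 : c.invm z * c.P z y * c.avoid y N z ≤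
        ∑' z, c.invm z * c.avoid y N z * c.P z y := by
      refine le_trans (le_of_eq ?_) (ENNReal.le_tsum z)
      ring
    refine (add_le_add_right h1 _).trans ?_
    rw [← ENNReal.tsum_add]
    refine ENNReal.tsum_le_tsum fun z => ?_
    have h2 : ∑' x, ({y}ᶜ : Set I).indicator (c.P z) x + c.P z y = 1 := by
      rw [← c.P_row z, ← tsum_indicator_add_compl {y} (c.P z), add_comm, ← tsum_subtype {y}]
      simp
    rw [← mul_add, h2, mul_one]
    rcases eq_or_ne z y with rfl | h
    · simp [avoid_self]
    · rw [Set.indicator_of_mem (by simpa using h)]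

section Recurrence

variable [Countable I] [MeasurableSingletonClass I]

lemma ET_ne_top_of_P_ne_zero {x y z : I} (hx : c.ET x y ≠ ⊤) (hP : c.P x z ≠ 0) :
    c.ET z y ≠ ⊤ := by
  intro htop
  rcases eq_or_ne x y with rfl | hxy
  · have h : c.invm z * c.P z x * c.ET z x ≤ 1 := by
      rw [ET_eq_tsum]
      refine le_of_tendsto' (ENNReal.Tendsto.const_mul
        (ENNReal.tendsto_nat_tsum fun n => c.avoid x n z) (Or.inr ?_)) fun N => ?_
      · exact ENNReal.mul_ne_top (c.invm_ne_top z)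
          (ne_top_of_le_ne_top one_ne_top (c.P_le_one z x))
      · exact le_add_self.trans (c.invm_mul_P_mul_sum_avoid_le x z N)
    rw [htop, ENNReal.mul_top (mul_ne_zero (c.invm_pos z) (c.P_symm hP))] at h
    exact absurd h (by simp)
  · have h : c.P x z * c.ET z y ≤ c.ET x y := by
      rw [ET_eq_tsum, ET_eq_tsum, ← ENNReal.tsum_mul_left,
        tsum_eq_zero_add' (f := fun n => c.avoid y n x) ENNReal.summable]
      refine le_trans (ENNReal.tsum_le_tsum fun n => ?_) le_add_self
      rw [avoid_succ c hxy]
      exact ENNReal.le_tsum z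
    rw [htop, ENNReal.mul_top hP, top_le_iff] at h
    exact hx h

/-- Positive recurrence: all mean hitting times are finite. -/
lemma ET_ne_top (x y : I) : c.ET x y ≠ ⊤ := by
  have hroot : ∀ n x, c.depth x = n → c.ET x y ≠ ⊤ → c.ET c.root y ≠ ⊤ := by
    intro n
    induction n with
    | zero => intro x hx h; rwa [← c.depth_eq_zero x hx]
    | succ n ih =>
      intro x hx h
      have hxr : x ≠ c.root := by
        rintro rfl
        simp [c.depth_root] at hx
      have := c.depth_par x hxr
      exact ih (c.par x) (by omega) (c.ET_ne_top_of_P_ne_zero h (c.mu_pos x hxr))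
  have hall : ∀ n x, c.depth x = n → c.ET x y ≠ ⊤ := by
    intro n
    induction n with
    | zero =>
      intro x hx
      rw [c.depth_eq_zero x hx]
      exact hroot _ y rfl (by simp [ET_self])
    | succ n ih =>
      intro x hx
      have hxr : x ≠ c.root := by
        rintro rfl
        simp [c.depth_root] at hx
      have := c.depth_par x hxr
      exact c.ET_ne_top_of_P_ne_zero (ih (c.par x) (by omega)) (c.lam_pos x hxr)
  exact hall _ x rfl

lemma tendsto_tsum_indicator_avoid (B : Set I) (y : I) :
    Tendsto (fun n => ∑' x, B.indicator (fun x => c.invm x * c.avoid y n x) x)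
      atTop (𝓝 0) := by
  have h : Tendsto (fun n => ∫⁻ x, B.indicator (fun x => c.invm x * c.avoid y n x) x
      ∂Measure.count) atTop (𝓝 (∫⁻ _, 0 ∂(Measure.count : Measure I))) := by
    refine tendsto_lintegral_of_dominated_convergence c.invm
      (fun n => measurable_of_countable _) (fun n => ae_of_all _ fun x => ?_) ?_
      (ae_of_all _ fun x => ?_)
    · by_cases hx : x ∈ B
      · simpa [hx] using mul_le_of_le_one_right' (c.avoid_le_one y n x)
      · simp [hx]
    · simp [lintegral_count, c.invm_sum]
    · by_cases hx : x ∈ B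
      · simp only [Set.indicator_of_mem hx]
        rw [← mul_zero (c.invm x)]
        refine ENNReal.Tendsto.const_mul ?_ (Or.inr (c.invm_ne_top x))
        exact ENNReal.tendsto_atTop_zero_of_tsum_ne_top (c.ET_eq_tsum x y ▸ c.ET_ne_top x y)
      · simp [hx]
  simpa [lintegral_count] using h

/-- Mean hitting times on the two sides of an edge `(v, w)` which is the only one leaving `B`. -/
lemma edge_formula {B : Set I} {v w y : I} (hv : v ∈ B) (hw : w ∉ B) (hy : y ∉ B)
    (hB : ∀ x ∈ B, ∀ z ∉ B, c.P x z ≠ 0 → x = v ∧ z = w) :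
    c.invm v * c.P v w * c.ET v y = c.piSet B + c.invm v * c.P v w * c.ET w y := by
  classical
  have hq : ∀ z, ∑' x, B.indicator (c.P z) x + (if z = v then c.P v w else 0) =
      B.indicator 1 z + (if z = w then c.P w v else 0) := by
    intro z
    by_cases hz : z ∈ B
    · have hzw : z ≠ w := fun h => hw (h ▸ hz)
      have : ∑' x, Bᶜ.indicator (c.P z) x = if z = v then c.P v w else 0 := by
        rw [tsum_eq_single w]
        · rw [Set.indicator_of_mem (by exact hw)]
          split_ifs with h
          · rw [h]
          · by_contra h0
            exact h (hB z hz w hw h0).1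
        · intro x hx
          refine Set.indicator_apply_eq_zero.2 fun hxB => ?_
          by_contra h0
          exact hx (hB z hz x hxB h0).2
      rw [← this, tsum_indicator_add_compl, c.P_row]
      simp [hz, hzw]
    · have hzv : z ≠ v := fun h => hz (h ▸ hv)
      have : ∑' x, B.indicator (c.P z) x = if z = w then c.P w v else 0 := by
        rw [tsum_eq_single v]
        · rw [Set.indicator_of_mem hv]
          split_ifs with h
          · rw [h]
          · by_contra h0
            exact h (hB v hv z hz (c.P_symm h0)).2
        · intro x hx
          refine Set.indicator_apply_eq_zero.2 fun hxB => ?_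
          by_contra h0
          exact hx (hB x hxB z hz (c.P_symm h0)).1
      rw [this]
      simp [hz, hzv]
  have hstep : ∀ n, ∑' x, B.indicator (fun x => c.invm x * c.avoid y (n + 1) x) x +
      c.invm v * c.P v w * c.avoid y n v =
      ∑' x, B.indicator (fun x => c.invm x * c.avoid y n x) x +
      c.invm v * c.P v w * c.avoid y n w := by
    intro n
    rw [tsum_indicator_avoid_succ c hy]
    have h1 : c.invm v * c.P v w * c.avoid y n v =
        ∑' z, c.invm z * c.avoid y n z * (if z = v then c.P v w else 0) := by
      rw [tsum_eq_single v (fun z hz => by simp [hz])]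
      simp only [if_true]; ring
    have h2 : c.invm v * c.P v w * c.avoid y n w =
        ∑' z, c.invm z * c.avoid y n z * (if z = w then c.P w v else 0) := by
      rw [tsum_eq_single w (fun z hz => by simp [hz]), c.invm_rev v w]
      simp only [if_true]; ring
    rw [h1, h2, ← ENNReal.tsum_add, ← ENNReal.tsum_add]
    refine tsum_congr fun z => ?_
    rw [← mul_add, hq, mul_add]
    congr 1
    by_cases hz : z ∈ B <;> simp [hz]
  have hsum : ∀ N, ∑' x, B.indicator (fun x => c.invm x * c.avoid y N x) x +
      c.invm v * c.P v w * ∑ n ∈ Finset.range N, c.avoid y n v =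
      c.piSet B + c.invm v * c.P v w * ∑ n ∈ Finset.range N, c.avoid y n w := by
    intro N
    induction N with
    | zero => simp [tsum_indicator_avoid_zero c hy]
    | succ N ih =>
      rw [Finset.sum_range_succ, Finset.sum_range_succ, mul_add, mul_add, ← add_assoc,
        ← add_assoc, ← ih, add_right_comm, hstep, add_right_comm]
  have hf : c.invm v * c.P v w ≠ ⊤ := ENNReal.mul_ne_top (c.invm_ne_top v)
    (ne_top_of_le_ne_top one_ne_top (c.P_le_one v w))
  have hlim : ∀ x, Tendsto
      (fun N => c.invm v * c.P v w * ∑ n ∈ Finset.range N, c.avoid y n x) atTop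
      (𝓝 (c.invm v * c.P v w * c.ET x y)) := fun x => by
    rw [ET_eq_tsum]
    exact ENNReal.Tendsto.const_mul (ENNReal.tendsto_nat_tsum _) (Or.inr hf)
  have hl := (c.tendsto_tsum_indicator_avoid B y).add (hlim v)
  rw [zero_add] at hl
  simp only [hsum] at hl
  exact tendsto_nhds_unique hl ((hlim w).const_add _)

end Recurrence

end HittingTimes

section Branches

variable {I : Type*} [MeasurableSpace I] (c : TreeChain I)

lemma mem_branch_self (x : I) : x ∈ c.branch x := ⟨0, rfl⟩

lemma depth_iterate_par (n : ℕ) (x : I) : c.depth (c.par^[n] x) = c.depth x - n := by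
  induction n with
  | zero => rfl
  | succ n ih =>
    rw [Function.iterate_succ_apply']
    by_cases h : c.par^[n] x = c.root
    · rw [h, c.depth_root] at ih
      rw [h, c.par_root, c.depth_root]
      omega
    · have := c.depth_par _ h
      omega

lemma depth_le_of_mem_branch {x y : I} (h : y ∈ c.branch x) : c.depth x ≤ c.depth y := by
  obtain ⟨n, rfl⟩ := h
  rw [depth_iterate_par]
  omega

lemma par_notMem_branch {x : I} (hx : x ≠ c.root) : c.par x ∉ c.branch x := fun h => by
  have := c.depth_le_of_mem_branch h
  have := c.depth_par x hx
  omega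

lemma root_notMem_branch {x : I} (hx : x ≠ c.root) : c.root ∉ c.branch x := fun h => by
  have := c.depth_le_of_mem_branch h
  rw [c.depth_root] at this
  exact hx (c.depth_eq_zero x (by omega))

lemma eq_of_exits_branch {x s z : I} (hs : s ∈ c.branch x) (hz : z ∉ c.branch x)
    (hP : c.P s z ≠ 0) : s = x ∧ z = c.par x := by
  obtain ⟨n, hn⟩ := hs
  rcases c.P_support s z hP with rfl | rfl | rfl
  · exact absurd ⟨n, hn⟩ hz
  · cases n with
    | zero =>
      obtain rfl : s = x := hn
      exact ⟨rfl, rfl⟩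
    | succ n => exact absurd ⟨n, hn⟩ hz
  · exact absurd ⟨n + 1, hn⟩ hz

lemma invm_mul_mu_ne_zero {x : I} (hx : x ≠ c.root) : c.invm x * c.mu x ≠ 0 :=
  mul_ne_zero (c.invm_pos x) (c.mu_pos x hx)

lemma invm_mul_mu_ne_top (x : I) : c.invm x * c.mu x ≠ ⊤ :=
  ENNReal.mul_ne_top (c.invm_ne_top x) (ne_top_of_le_ne_top one_ne_top (c.P_le_one _ _))

lemma iterate_par_ne_root {a : I} {i : ℕ} (hi : i < c.depth a) : c.par^[i] a ≠ c.root := by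
  intro h
  have := c.depth_iterate_par i a
  rw [h, c.depth_root] at this
  omega

lemma iterate_par_mem_branch_alphaVert {a : I} {i : ℕ} (hi : i < c.depth a) :
    c.par^[i] a ∈ c.branch (c.alphaVert a) := by
  refine ⟨c.depth a - 1 - i, ?_⟩
  rw [← Function.iterate_add_apply, alphaVert]
  congr 2
  omega

lemma sum_invm_path_le_one (a : I) :
    ∑ i ∈ Finset.range (c.depth a), c.invm (c.par^[i] a) ≤ 1 := by
  classical
  rw [← c.invm_sum, ← Finset.sum_image (f := c.invm) (g := fun i => c.par^[i] a)]
  · exact ENNReal.sum_le_tsum _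
  · intro i hi j hj hij
    have h1 := c.depth_iterate_par i a
    have h2 := c.depth_iterate_par j a
    simp only [Finset.coe_range, Set.mem_Iio] at hi hj
    simp only at hij
    rw [hij] at h1
    omega

variable [Countable I] [MeasurableSingletonClass I]

lemma ET_eq_add_ET_par {x y : I} (hx : x ≠ c.root) (hy : y ∉ c.branch x) :
    c.ET x y = c.piSet (c.branch x) / (c.invm x * c.mu x) + c.ET (c.par x) y := by
  have h : c.invm x * c.mu x * c.ET x y =
      c.piSet (c.branch x) + c.invm x * c.mu x * c.ET (c.par x) y :=
    c.edge_formula (c.mem_branch_self x) (c.par_notMem_branch hx) hy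
      fun s hs z hz hP => c.eq_of_exits_branch hs hz hP
  have h0 := c.invm_mul_mu_ne_zero hx
  have ht := c.invm_mul_mu_ne_top x
  refine (ENNReal.mul_right_inj h0 ht).1 ?_
  rw [h, mul_add, ENNReal.mul_div_cancel h0 ht]

lemma ET_par_eq_add_ET {x y : I} (hx : x ≠ c.root) (hy : y ∈ c.branch x) :
    c.ET (c.par x) y = c.piSet (c.branch x)ᶜ / (c.invm x * c.mu x) + c.ET x y := by
  have h := c.edge_formula (B := (c.branch x)ᶜ) (v := c.par x) (w := x) (y := y)
    (c.par_notMem_branch hx) (fun h => h (c.mem_branch_self x)) (fun h => h hy)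
    fun s hs z hz hP => (c.eq_of_exits_branch (not_not.1 hz) hs (c.P_symm hP)).symm
  rw [← c.invm_rev x (c.par x)] at h
  have h0 := c.invm_mul_mu_ne_zero hx
  have ht := c.invm_mul_mu_ne_top x
  refine (ENNReal.mul_right_inj h0 ht).1 ?_
  rw [mul_add, ENNReal.mul_div_cancel h0 ht]
  exact h

lemma ET_root_eq_sum (a : I) :
    c.ET a c.root = ∑ i ∈ Finset.range (c.depth a),
      c.piSet (c.branch (c.par^[i] a)) / (c.invm (c.par^[i] a) * c.mu (c.par^[i] a)) := by
  have h : ∀ k ≤ c.depth a, c.ET a c.root = ∑ i ∈ Finset.range k,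
      c.piSet (c.branch (c.par^[i] a)) / (c.invm (c.par^[i] a) * c.mu (c.par^[i] a)) +
        c.ET (c.par^[k] a) c.root := by
    intro k
    induction k with
    | zero => simp
    | succ k ih =>
      intro hk
      have hr := c.iterate_par_ne_root (show k < c.depth a by omega)
      rw [Finset.sum_range_succ, add_assoc, Function.iterate_succ_apply', ih (by omega),
        ← c.ET_eq_add_ET_par hr (c.root_notMem_branch hr)]
  have hroot : c.par^[c.depth a] a = c.root :=
    c.depth_eq_zero _ (by rw [depth_iterate_par, Nat.sub_self])
  rw [h _ le_rfl, hroot, ET_self, add_zero]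

lemma ET_from_root_eq_sum (a : I) :
    c.ET c.root a = ∑ i ∈ Finset.range (c.depth a),
      c.piSet (c.branch (c.par^[i] a))ᶜ / (c.invm (c.par^[i] a) * c.mu (c.par^[i] a)) := by
  have h : ∀ k ≤ c.depth a, c.ET (c.par^[k] a) a = ∑ i ∈ Finset.range k,
      c.piSet (c.branch (c.par^[i] a))ᶜ / (c.invm (c.par^[i] a) * c.mu (c.par^[i] a)) := by
    intro k
    induction k with
    | zero => simp [ET_self]
    | succ k ih =>
      intro hk
      have hr := c.iterate_par_ne_root (show k < c.depth a by omega)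
      rw [Finset.sum_range_succ, Function.iterate_succ_apply',
        c.ET_par_eq_add_ET hr ⟨k, rfl⟩, ih (by omega), add_comm]
  have hroot : c.par^[c.depth a] a = c.root :=
    c.depth_eq_zero _ (by rw [depth_iterate_par, Nat.sub_self])
  rw [← h _ le_rfl, hroot]

lemma piSet_branch_le_Kdrift_mul {a b : I} (hb : b ∈ c.branch (c.alphaVert a))
    (hr : b ≠ c.root) : c.piSet (c.branch b) ≤ c.Kdrift a * c.invm b := by
  have h : c.mu b * c.ET b (c.par b) ≤ c.Kdrift a :=
    le_iSup₂ (f := fun b (_ : b ∈ c.branch (c.alphaVert a)) => c.mu b * c.ET b (c.par b)) b hb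
  have h' := c.ET_eq_add_ET_par hr (c.par_notMem_branch hr)
  rw [ET_self, add_zero] at h'
  calc c.piSet (c.branch b) = c.invm b * c.mu b * c.ET b (c.par b) := by
        rw [h', ENNReal.mul_div_cancel (c.invm_mul_mu_ne_zero hr) (c.invm_mul_mu_ne_top b)]
    _ = c.mu b * c.ET b (c.par b) * c.invm b := by ring
    _ ≤ _ := mul_le_mul_left h _

/-- Comparison of the descent time with the escape time. -/
lemma ET_root_le {a : I} {κ δ : ℝ≥0∞} (hδ : δ ≠ 0) (hδt : δ ≠ ⊤)
    (hκ : ∀ b ∈ c.branch (c.alphaVert a), κ ≤ c.mu b) :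
    c.ET a c.root ≤ δ * c.ET c.root a + (1 + δ⁻¹) * κ⁻¹ * c.Kdrift a ^ 2 := by
  have hterm : ∀ i ∈ Finset.range (c.depth a),
      c.piSet (c.branch (c.par^[i] a)) / (c.invm (c.par^[i] a) * c.mu (c.par^[i] a)) ≤
      δ * (c.piSet (c.branch (c.par^[i] a))ᶜ / (c.invm (c.par^[i] a) * c.mu (c.par^[i] a))) +
        (1 + δ⁻¹) * κ⁻¹ * c.Kdrift a ^ 2 * c.invm (c.par^[i] a) := by
    intro i hi
    rw [Finset.mem_range] at hi
    have hr := c.iterate_par_ne_root hi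
    have hb := c.iterate_par_mem_branch_alphaVert hi
    generalize c.par^[i] a = b at hr hb
    have hK := c.piSet_branch_le_Kdrift_mul hb hr
    by_cases hle : c.piSet (c.branch b) ≤ δ * c.piSet (c.branch b)ᶜ
    · refine le_add_right ?_
      rw [← mul_div_assoc]
      exact ENNReal.div_le_div_right hle _
    · refine le_add_left ?_
      have h1 : 1 ≤ (1 + δ⁻¹) * c.piSet (c.branch b) := by
        rw [add_mul, one_mul, ← c.piSet_add_compl (c.branch b)]
        refine add_le_add_right ?_ _
        have := mul_le_mul_right (not_le.1 hle).le δ⁻¹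
        rwa [← mul_assoc, ENNReal.inv_mul_cancel hδ hδt, one_mul] at this
      have h2 : 1 ≤ (1 + δ⁻¹) * (c.Kdrift a * c.invm b) :=
        h1.trans (mul_le_mul_right hK _)
      have h3 : c.piSet (c.branch b) / (c.invm b * c.mu b) ≤ κ⁻¹ * c.Kdrift a := by
        refine ENNReal.div_le_of_le_mul (hK.trans ?_)
        have h4 : 1 ≤ κ⁻¹ * c.mu b := by
          rw [← ENNReal.inv_mul_cancel (c.mu_pos b hr)
            (ne_top_of_le_ne_top one_ne_top (c.P_le_one b (c.par b)))]
          exact mul_le_mul_left (ENNReal.inv_le_inv.2 (hκ b hb)) _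
        calc c.Kdrift a * c.invm b = 1 * (c.Kdrift a * c.invm b) := (one_mul _).symm
          _ ≤ κ⁻¹ * c.mu b * (c.Kdrift a * c.invm b) := mul_le_mul_left h4 _
          _ = _ := by ring
      calc c.piSet (c.branch b) / (c.invm b * c.mu b) ≤ 1 * (κ⁻¹ * c.Kdrift a) := by
            rwa [one_mul]
        _ ≤ (1 + δ⁻¹) * (c.Kdrift a * c.invm b) * (κ⁻¹ * c.Kdrift a) := mul_le_mul_left h2 _
        _ = _ := by ring
  rw [c.ET_root_eq_sum, c.ET_from_root_eq_sum, Finset.mul_sum]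
  refine (Finset.sum_le_sum hterm).trans ?_
  rw [Finset.sum_add_distrib, ← Finset.mul_sum, ← Finset.mul_sum]
  exact add_le_add_right (mul_le_of_le_one_right' (c.sum_invm_path_le_one a)) _

end Branches

end TreeChain

/-- **Proposition 2** (two time scales): under the `0^ℓ-SD` condition,
`E[T^a_0]/E[T^0_a] → 0` as `a → ∞`. -/
theorem timescale_of_strongDrift {I : ℕ → Type*} [∀ n, MeasurableSpace (I n)]
    [∀ n, Countable (I n)] (c : ∀ n, TreeChain (I n)) (a : ∀ n, I n)
    (hdepth : Tendsto (fun n => (c n).depth (a n)) atTop atTop)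
    (hSD : StrongDrift c a) :
    Tendsto (fun n => (c n).ET (a n) (c n).root / (c n).ET (c n).root (a n))
      atTop (𝓝 0) := by
  obtain ⟨⟨κ, hκ0, hκ⟩, hlim⟩ := hSD
  rw [ENNReal.tendsto_nhds_zero]
  intro ε hε
  rcases eq_or_ne ε ⊤ with rfl | hεt
  · exact Eventually.of_forall fun n => le_top
  have hδ : ε / 2 ≠ 0 := (ENNReal.half_pos hε.ne').ne'
  have hδt : ε / 2 ≠ ⊤ := ENNReal.div_ne_top hεt two_ne_zero
  have hC : (1 + (ε / 2)⁻¹) * κ⁻¹ ≠ ⊤ :=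
    ENNReal.mul_ne_top (ENNReal.add_ne_top.2 ⟨one_ne_top, ENNReal.inv_ne_top.2 hδ⟩)
      (ENNReal.inv_ne_top.2 hκ0.ne')
  have hη : 0 < (2 * ((1 + (ε / 2)⁻¹) * κ⁻¹))⁻¹ :=
    ENNReal.inv_pos.2 (ENNReal.mul_ne_top ofNat_ne_top hC)
  filter_upwards [ENNReal.tendsto_nhds_zero.1 hlim _ hη] with n hn
  have := (c n).measurableSingletonClass
  have hE := (c n).ET_ne_top (a n) (c n).root
  have hmain := (c n).ET_root_le hδ hδt (hκ n)
  generalize (1 + (ε / 2)⁻¹) * κ⁻¹ = C at *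
  generalize (c n).ET (a n) (c n).root = E at *
  generalize (c n).ET (c n).root (a n) = F at *
  generalize (c n).Kdrift (a n) ^ 2 = K at *
  rcases eq_or_ne E 0 with rfl | hE0
  · simp
  refine ENNReal.div_le_of_le_mul ?_
  rw [ENNReal.div_le_iff hE0 hE] at hn
  have h1 : 2 * (C * K) ≤ E := by
    calc 2 * (C * K) ≤ 2 * (C * ((2 * C)⁻¹ * E)) := by gcongr
      _ = (2 * C) * (2 * C)⁻¹ * E := by ring
      _ ≤ 1 * E := by gcongr; exact ENNReal.mul_inv_le_one _
      _ = E := one_mul E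
  have h2 : E + E ≤ ε * F + E := by
    calc E + E = 2 * E := (two_mul E).symm
      _ ≤ 2 * (ε / 2 * F + C * K) := by gcongr
      _ = 2 * (ε / 2) * F + 2 * (C * K) := by ring
      _ ≤ ε * F + E := by
        rw [ENNReal.mul_div_cancel two_ne_zero ofNat_ne_top]
        gcongr
  exact (ENNReal.add_le_add_iff_right hE).1 h2
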